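/- arXiv:2402.04074 — 3 statements merged into one kernel-verified Lean document; each statement's English description precedes it below -/
import Mathlib

section
/- Let (Ω, F, P) be a probability space and let χ̄₁, χ̄₂ be natural numbers. For i = 1, 2 and each n ∈ ℤ, let h⁽ⁱ⁾(n) : Ω → ℝ^{χ̄ᵢ+1} be a random vector with E[h⁽ⁱ⁾(n)] = 0 and let uᵢ(n) : Ω → ℝ be a random variable; assume every product h⁽¹⁾_{j₁}(n₁)·h⁽²⁾_{j₂}(n₂)·u₁(n₁)·u₂(n₂) is integrable. Assume that for all n₁ ≥ n₂ the random vector h⁽¹⁾(n₁) is independent of the random vector (h⁽²⁾(n₂), u₁(n₁), u₂(n₂)), and for all n₂ ≥ n₁ the random vector h⁽²⁾(n₂) is independent of (h⁽¹⁾(n₁), u₁(n₁), u₂(n₂)). Define d₁(k) = Σ_{j=0}^{χ̄₁} h⁽¹⁾_j(k−j)·u₁(k−j) and d₂(k) = Σ_{j=0}^{χ̄₂} h⁽²⁾_j(k−j)·u₂(k−j). Then E[d₁(k₁)·d₂(k₂)] = 0 for all k₁, k₂ ∈ ℤ. -/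
open MeasureTheory ProbabilityTheory

/-- A product of a zero-mean function of `X` with a function of an independent `Y` has
zero mean. -/
lemma integral_mul_eq_zero_of_indepFun {Ω α β : Type*} [MeasurableSpace Ω]
    [MeasurableSpace α] [MeasurableSpace β] {P : Measure Ω} {X : Ω → α} {Y : Ω → β}
    (hXY : IndepFun X Y P) (hX : Measurable X) (hY : Measurable Y) {f : α → ℝ} {g : β → ℝ}
    (hf : Measurable f) (hg : Measurable g) (hmean : ∫ ω, f (X ω) ∂P = 0) :
    ∫ ω, f (X ω) * g (Y ω) ∂P = 0 := by
  have h := (hXY.comp hf hg).integral_fun_mul_eq_mul_integral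
    (hf.comp hX).aestronglyMeasurable (hg.comp hY).aestronglyMeasurable
  simpa [Function.comp_def, hmean] using h

/-- Lemma 3 of the paper: the outputs of two distinct stochastic uncertainty
channels, each a finite random moving-average of its input with zero-mean
coefficient vectors, are orthogonal. -/
theorem outputs_orthogonal {Ω : Type*} [MeasurableSpace Ω]
    (P : Measure Ω) [IsProbabilityMeasure P]
    (χ1 χ2 : ℕ)
    (h1 : ℤ → Ω → Fin (χ1 + 1) → ℝ) (h2 : ℤ → Ω → Fin (χ2 + 1) → ℝ)
    (u1 u2 : ℤ → Ω → ℝ)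
    (hmeas1 : ∀ n, Measurable (h1 n)) (hmeas2 : ∀ n, Measurable (h2 n))
    (humeas1 : ∀ n, Measurable (u1 n)) (humeas2 : ∀ n, Measurable (u2 n))
    (hmean1 : ∀ n j, ∫ ω, h1 n ω j ∂P = 0)
    (hmean2 : ∀ n j, ∫ ω, h2 n ω j ∂P = 0)
    (hint : ∀ (n1 n2 : ℤ) (j1 : Fin (χ1 + 1)) (j2 : Fin (χ2 + 1)),
      Integrable (fun ω => h1 n1 ω j1 * h2 n2 ω j2 * u1 n1 ω * u2 n2 ω) P)
    (hindep1 : ∀ n1 n2 : ℤ, n2 ≤ n1 →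
      IndepFun (h1 n1) (fun ω => (h2 n2 ω, u1 n1 ω, u2 n2 ω)) P)
    (hindep2 : ∀ n1 n2 : ℤ, n1 ≤ n2 →
      IndepFun (h2 n2) (fun ω => (h1 n1 ω, u1 n1 ω, u2 n2 ω)) P) :
    ∀ k1 k2 : ℤ,
      ∫ ω, (∑ j : Fin (χ1 + 1), h1 (k1 - (j : ℕ)) ω j * u1 (k1 - (j : ℕ)) ω) *
            (∑ j : Fin (χ2 + 1), h2 (k2 - (j : ℕ)) ω j * u2 (k2 - (j : ℕ)) ω) ∂P
        = 0 := by
  intro k1 k2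
  have hzero (n1 n2 : ℤ) (j1 : Fin (χ1 + 1)) (j2 : Fin (χ2 + 1)) :
      ∫ ω, h1 n1 ω j1 * h2 n2 ω j2 * u1 n1 ω * u2 n2 ω ∂P = 0 := by
    rcases le_total n2 n1 with hle | hle
    · have h := integral_mul_eq_zero_of_indepFun (hindep1 n1 n2 hle) (hmeas1 n1)
        ((hmeas2 n2).prodMk ((humeas1 n1).prodMk (humeas2 n2)))
        (f := fun x => x j1) (g := fun y => y.1 j2 * y.2.1 * y.2.2)
        (by fun_prop) (by fun_prop) (hmean1 n1 j1)
      simpa only [mul_assoc] using h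
    · have h := integral_mul_eq_zero_of_indepFun (hindep2 n1 n2 hle) (hmeas2 n2)
        ((hmeas1 n1).prodMk ((humeas1 n1).prodMk (humeas2 n2)))
        (f := fun x => x j2) (g := fun y => y.1 j1 * y.2.1 * y.2.2)
        (by fun_prop) (by fun_prop) (hmean2 n2 j2)
      rw [← h]
      congr with ω
      ring
  have hexpand (ω : Ω) :
      (∑ j : Fin (χ1 + 1), h1 (k1 - (j : ℕ)) ω j * u1 (k1 - (j : ℕ)) ω) *
            (∑ j : Fin (χ2 + 1), h2 (k2 - (j : ℕ)) ω j * u2 (k2 - (j : ℕ)) ω) =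
        ∑ i : Fin (χ1 + 1), ∑ j : Fin (χ2 + 1), h1 (k1 - (i : ℕ)) ω i *
          h2 (k2 - (j : ℕ)) ω j * u1 (k1 - (i : ℕ)) ω * u2 (k2 - (j : ℕ)) ω := by
    rw [Finset.sum_mul_sum]
    refine Finset.sum_congr rfl fun i _ => Finset.sum_congr rfl fun j _ => ?_
    ring
  simp_rw [hexpand]
  rw [integral_finsetSum _ fun i _ => integrable_finsetSum _ fun j _ => hint _ _ i j]
  refine Finset.sum_eq_zero fun i _ => ?_
  rw [integral_finsetSum _ fun j _ => hint _ _ i j]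
  exact Finset.sum_eq_zero fun j _ => hzero _ _ i j
end

section
/- Let (Ω, F, P) be a probability space and χ̄ a natural number. For each n ∈ ℤ, let h(n) : Ω → ℝ^{χ̄+1} be a random vector with E[h(n)] = 0 and E[h(n) h(n)ᵀ] = R (the same (χ̄+1)×(χ̄+1) matrix for all n), and let u(n) : Ω → ℝ be a random variable; assume all products h_{j₁}(n₁)·h_{j₂}(n₂)·u(n₁)·u(n₂) are integrable. Assume that for each n the vector h(n) is independent of u(n), and that for all n₁ > n₂ the vector h(n₁) is independent of the random vector (h(n₂), u(n₁), u(n₂)). Define d(k) = Σ_{j=0}^{χ̄} h_j(k−j)·u(k−j). Then for every k ∈ ℤ and every integer λ with 0 ≤ λ ≤ χ̄, E[d(k+λ)·d(k)] = Σ_{j=0}^{χ̄−λ} R_{j,(j+λ)} · E[u(k−j)²], and E[d(k+λ)·d(k)] = 0 whenever λ > χ̄. -/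
open MeasureTheory ProbabilityTheory

/-- A centred coordinate of a random vector `X` is orthogonal to every function of a random
variable independent of `X`. -/
theorem integral_coord_mul_eq_zero_of_indepFun {Ω ι β : Type*} [MeasurableSpace Ω]
    [MeasurableSpace β] {P : Measure Ω} {X : Ω → ι → ℝ} {Y : Ω → β} {i : ι} {g : β → ℝ}
    (hX : Measurable X) (hY : Measurable Y) (hg : Measurable g)
    (hmean : ∫ ω, X ω i ∂P = 0) (hXY : IndepFun X Y P) :
    ∫ ω, X ω i * g (Y ω) ∂P = 0 := by
  have hind : IndepFun (fun ω => X ω i) (fun ω => g (Y ω)) P :=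
    hXY.comp (measurable_pi_apply i) hg
  rw [hind.integral_fun_mul_eq_mul_integral (by fun_prop)
    (hg.comp hY).aestronglyMeasurable, hmean, zero_mul]

/-- The products `h(a)_i u(a)` and `h(b)_j u(b)` are uncorrelated for `a ≠ b`, and for `a = b`
their correlation is `E[h(a)_i h(a)_j] E[u(a)²]`. -/
theorem integral_coeff_mul_input_mul {Ω ι : Type*} [MeasurableSpace Ω] {P : Measure Ω}
    {h : ℤ → Ω → ι → ℝ} {u : ℤ → Ω → ℝ}
    (hmeas : ∀ n, Measurable (h n)) (umeas : ∀ n, Measurable (u n))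
    (hmean : ∀ n j, ∫ ω, h n ω j ∂P = 0)
    {R : Matrix ι ι ℝ} (hcov : ∀ n j l, ∫ ω, h n ω j * h n ω l ∂P = R j l)
    (hindep0 : ∀ n, IndepFun (h n) (u n) P)
    (hindep : ∀ n1 n2 : ℤ, n2 < n1 →
      IndepFun (h n1) (fun ω => (h n2 ω, u n1 ω, u n2 ω)) P)
    (a b : ℤ) (i j : ι) :
    ∫ ω, (h a ω i * u a ω) * (h b ω j * u b ω) ∂P =
      if a = b then R i j * ∫ ω, u b ω ^ 2 ∂P else 0 := by
  have key (n1 n2 : ℤ) (hlt : n2 < n1) (i j : ι) :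
      ∫ ω, (h n1 ω i * u n1 ω) * (h n2 ω j * u n2 ω) ∂P = 0 := by
    rw [← integral_coord_mul_eq_zero_of_indepFun
      (g := fun p : (ι → ℝ) × ℝ × ℝ => p.1 j * p.2.1 * p.2.2) (hmeas n1)
      ((hmeas n2).prodMk ((umeas n1).prodMk (umeas n2))) (by fun_prop) (hmean n1 i)
      (hindep n1 n2 hlt)]
    congr 1 with ω
    ring
  rcases lt_trichotomy a b with hab | rfl | hab
  · rw [if_neg hab.ne, ← key b a hab j i]
    simp only [mul_comm]
  · have hind : IndepFun (fun ω => h a ω i * h a ω j) (fun ω => u a ω ^ 2) P :=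
      (hindep0 a).comp (φ := fun x : ι → ℝ => x i * x j) (ψ := fun x : ℝ => x ^ 2)
        (by fun_prop) (by fun_prop)
    rw [if_pos rfl, ← hcov a i j,
      ← hind.integral_fun_mul_eq_mul_integral (by fun_prop) (by fun_prop)]
    congr 1 with ω
    ring
  · rw [if_neg hab.ne', key a b hab i j]

/-- The autocorrelation identity of the paper's Lemma 2: the output
`d(k) = Σ_{j=0}^{χ̄} h_j(k−j) u(k−j)` of the zero-mean correlated stochastic
uncertainty with i.i.d. zero-mean coefficient vectors of covariance `R`
satisfies `E[d(k+λ) d(k)] = Σ_{j=0}^{χ̄−λ} R_{j,j+λ} E[u(k−j)²]` for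
`0 ≤ λ ≤ χ̄`, and `E[d(k+λ) d(k)] = 0` for `λ > χ̄`. -/
theorem autocorrelation_identity {Ω : Type*} [MeasurableSpace Ω]
    (P : Measure Ω) [IsProbabilityMeasure P]
    (χ : ℕ) (h : ℤ → Ω → Fin (χ + 1) → ℝ) (u : ℤ → Ω → ℝ)
    (hmeas : ∀ n, Measurable (h n)) (umeas : ∀ n, Measurable (u n))
    (hmean : ∀ n j, ∫ ω, h n ω j ∂P = 0)
    (R : Matrix (Fin (χ + 1)) (Fin (χ + 1)) ℝ)
    (hcov : ∀ n j l, ∫ ω, h n ω j * h n ω l ∂P = R j l)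
    (hint : ∀ (n1 n2 : ℤ) (j1 j2 : Fin (χ + 1)),
      Integrable (fun ω => h n1 ω j1 * h n2 ω j2 * u n1 ω * u n2 ω) P)
    (hindep0 : ∀ n, IndepFun (h n) (u n) P)
    (hindep : ∀ n1 n2 : ℤ, n2 < n1 →
      IndepFun (h n1) (fun ω => (h n2 ω, u n1 ω, u n2 ω)) P)
    (k : ℤ) (lam : ℕ) :
    (∀ hle : lam ≤ χ,
      ∫ ω, (∑ j : Fin (χ + 1), h (k + lam - (j : ℕ)) ω j * u (k + lam - (j : ℕ)) ω) *
            (∑ j : Fin (χ + 1), h (k - (j : ℕ)) ω j * u (k - (j : ℕ)) ω) ∂P =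
        ∑ j : Fin (χ + 1 - lam),
          R (Fin.castLE (by omega) j) ⟨(j : ℕ) + lam, by have := j.isLt; omega⟩ *
            ∫ ω, u (k - (j : ℕ)) ω ^ 2 ∂P) ∧
    (χ < lam →
      ∫ ω, (∑ j : Fin (χ + 1), h (k + lam - (j : ℕ)) ω j * u (k + lam - (j : ℕ)) ω) *
            (∑ j : Fin (χ + 1), h (k - (j : ℕ)) ω j * u (k - (j : ℕ)) ω) ∂P = 0) := by
  have expand :
      ∫ ω, (∑ j : Fin (χ + 1), h (k + lam - (j : ℕ)) ω j * u (k + lam - (j : ℕ)) ω) *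
            (∑ j : Fin (χ + 1), h (k - (j : ℕ)) ω j * u (k - (j : ℕ)) ω) ∂P =
        ∑ p : Fin (χ + 1) × Fin (χ + 1),
          if k + lam - (p.1 : ℕ) = k - (p.2 : ℕ) then
            R p.1 p.2 * ∫ ω, u (k - (p.2 : ℕ)) ω ^ 2 ∂P else 0 := by
    simp only [Finset.sum_mul_sum, ← Fintype.sum_prod_type']
    rw [integral_finsetSum]
    · exact Finset.sum_congr rfl fun p _ =>
        integral_coeff_mul_input_mul hmeas umeas hmean hcov hindep0 hindep _ _ _ _
    · intro p _
      convert hint (k + lam - (p.1 : ℕ)) (k - (p.2 : ℕ)) p.1 p.2 using 2 with ω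
      ring
  have hsymm (i j : Fin (χ + 1)) : R i j = R j i := by
    rw [← hcov 0 i j, ← hcov 0 j i]
    simp only [mul_comm]
  rw [expand]
  refine ⟨fun hle => ?_, fun hlt => ?_⟩
  · symm
    refine Finset.sum_of_injOn
      (fun j : Fin (χ + 1 - lam) =>
        ((⟨(j : ℕ) + lam, by have := j.isLt; omega⟩ : Fin (χ + 1)),
          (Fin.castLE (by omega) j : Fin (χ + 1)))) ?_ ?_ ?_ ?_
    · intro a _ b _ hab
      exact Fin.ext (congrArg (fun p => (p.2 : ℕ)) hab)
    · simp
    · rintro ⟨p, q⟩ _ hpq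
      refine if_neg fun heq => hpq ?_
      dsimp only at heq
      refine ⟨⟨q, by omega⟩, by simp, Prod.ext (Fin.ext ?_) (Fin.ext rfl)⟩
      dsimp only
      omega
    · intro j _
      rw [if_pos (by simp), hsymm]
      rfl
  · refine Finset.sum_eq_zero fun p _ => if_neg ?_
    omega
end

section
/- Under the hypotheses of the preceding autocorrelation identity (h(n) zero-mean with common covariance R, h(n) independent of u(n), h(n₁) independent of (h(n₂), u(n₁), u(n₂)) for n₁ > n₂, all products integrable, and d(k) = Σ_{j=0}^{χ̄} h_j(k−j)·u(k−j)), assume in addition that the limit P := lim_{N→∞} (1/N) Σ_{k=0}^{N−1} E[u(k)²] exists. Then for every integer λ with 0 ≤ λ ≤ χ̄, lim_{N→∞} (1/N) Σ_{k=0}^{N−1} E[d(k+λ)·d(k)] = r(λ)·P, where r(λ) := Σ_{j=0}^{χ̄−λ} R_{j,(j+λ)}. -/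
open MeasureTheory ProbabilityTheory Filter

/-- Cesàro limits of a two-sided sequence are invariant under a finite delay. -/
theorem tendsto_cesaro_delay {a : ℤ → ℝ} {L : ℝ}
    (ha : Tendsto (fun N : ℕ => (1 / (N : ℝ)) * ∑ k ∈ Finset.range N, a (k : ℤ)) atTop (nhds L))
    (l : ℕ) :
    Tendsto (fun N : ℕ => (1 / (N : ℝ)) * ∑ k ∈ Finset.range N, a ((k : ℤ) - l))
      atTop (nhds L) := by
  rw [← tendsto_add_atTop_iff_nat l]
  have hinv : Tendsto (fun N : ℕ => 1 / ((N + l : ℕ) : ℝ)) atTop (nhds 0) :=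
    (tendsto_add_atTop_iff_nat (f := fun N : ℕ => 1 / (N : ℝ)) l).2
      tendsto_one_div_atTop_nhds_zero_nat
  have hlim := (hinv.mul_const (∑ k ∈ Finset.range l, a ((k : ℤ) - l))).add
    (((hinv.mul_const (l : ℝ)).const_sub 1).mul ha)
  simp only [zero_mul, sub_zero, one_mul, zero_add] at hlim
  refine hlim.congr' ?_
  filter_upwards [eventually_gt_atTop 0] with N hN
  have hN' : (N : ℝ) ≠ 0 := by positivity
  have hNl : (N : ℝ) + l ≠ 0 := by positivity
  rw [add_comm N l, Finset.sum_range_add]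
  have hshift : ∀ k : ℕ, ((l + k : ℕ) : ℤ) - l = k := fun k => by push_cast; ring
  simp only [hshift]
  push_cast
  have hlN : (l : ℝ) + N ≠ 0 := by positivity
  field_simp
  ring

section UncertainGain

variable {Ω ι : Type*} [MeasurableSpace Ω] {P : Measure Ω} {h : ℤ → Ω → ι → ℝ} {u : ℤ → Ω → ℝ}

/-- A zero-mean gain that is independent of the earlier gain and of both inputs yields
uncorrelated products. -/
theorem integral_gain_input_eq_zero_of_lt
    (hmeas : ∀ n, Measurable (h n)) (umeas : ∀ n, Measurable (u n))
    (hmean : ∀ n j, ∫ ω, h n ω j ∂P = 0)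
    (hindep : ∀ n1 n2 : ℤ, n2 < n1 →
      IndepFun (h n1) (fun ω => (h n2 ω, u n1 ω, u n2 ω)) P)
    {n m : ℤ} (hlt : m < n) (j l : ι) :
    ∫ ω, (h n ω j * u n ω) * (h m ω l * u m ω) ∂P = 0 := by
  have hind : IndepFun (fun ω => h n ω j) (fun ω => h m ω l * u n ω * u m ω) P :=
    (hindep n m hlt).comp (φ := fun x : ι → ℝ => x j)
      (ψ := fun p : (ι → ℝ) × ℝ × ℝ => p.1 l * p.2.1 * p.2.2)
      (by fun_prop) (by fun_prop)
  have hcoord : ∀ n j, Measurable fun ω => h n ω j := fun n j =>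
    (measurable_pi_apply j).comp (hmeas n)
  calc ∫ ω, (h n ω j * u n ω) * (h m ω l * u m ω) ∂P
      = ∫ ω, h n ω j * (h m ω l * u n ω * u m ω) ∂P := by
        congr 1 with ω
        ring
    _ = 0 := by
        rw [hind.integral_fun_mul_eq_mul_integral (hcoord n j).aestronglyMeasurable
          (((hcoord m l).mul (umeas n)).mul (umeas m)).aestronglyMeasurable, hmean, zero_mul]

/-- At distinct times the products of gain and input are uncorrelated. -/
theorem integral_gain_input_eq_zero_of_ne
    (hmeas : ∀ n, Measurable (h n)) (umeas : ∀ n, Measurable (u n))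
    (hmean : ∀ n j, ∫ ω, h n ω j ∂P = 0)
    (hindep : ∀ n1 n2 : ℤ, n2 < n1 →
      IndepFun (h n1) (fun ω => (h n2 ω, u n1 ω, u n2 ω)) P)
    {n m : ℤ} (hne : n ≠ m) (j l : ι) :
    ∫ ω, (h n ω j * u n ω) * (h m ω l * u m ω) ∂P = 0 := by
  rcases hne.lt_or_gt with hlt | hlt
  · simp only [mul_comm (h n _ j * u n _)]
    exact integral_gain_input_eq_zero_of_lt hmeas umeas hmean hindep hlt l j
  · exact integral_gain_input_eq_zero_of_lt hmeas umeas hmean hindep hlt j l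

/-- At equal times the correlation factors into the gain covariance and the input power. -/
theorem integral_gain_input_same_time
    (hmeas : ∀ n, Measurable (h n)) (umeas : ∀ n, Measurable (u n))
    (hindep0 : ∀ n, IndepFun (h n) (u n) P) (n : ℤ) (j l : ι) :
    ∫ ω, (h n ω j * u n ω) * (h n ω l * u n ω) ∂P
      = (∫ ω, h n ω j * h n ω l ∂P) * ∫ ω, u n ω ^ 2 ∂P := by
  have hind : IndepFun (fun ω => h n ω j * h n ω l) (fun ω => u n ω ^ 2) P :=
    (hindep0 n).comp (φ := fun x : ι → ℝ => x j * x l) (ψ := fun x : ℝ => x ^ 2)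
      (by fun_prop) (by fun_prop)
  have hcoord : ∀ j, Measurable fun ω => h n ω j := fun j =>
    (measurable_pi_apply j).comp (hmeas n)
  rw [← hind.integral_fun_mul_eq_mul_integral
    ((hcoord j).mul (hcoord l)).aestronglyMeasurable ((umeas n).pow_const 2).aestronglyMeasurable]
  congr 1 with ω
  ring

end UncertainGain

/-- A double sum supported on the `lam`-th subdiagonal is a single sum along it. -/
theorem Fin.sum_sum_subdiagonal {χ lam : ℕ} (F : Fin (χ + 1) → Fin (χ + 1) → ℝ)
    (hF : ∀ j l : Fin (χ + 1), (j : ℕ) ≠ l + lam → F j l = 0) :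
    ∑ j, ∑ l, F j l = ∑ i : Fin (χ + 1 - lam),
      F ⟨(i : ℕ) + lam, by have := i.isLt; omega⟩ (Fin.castLE (by omega) i) := by
  rw [← Finset.sum_product']
  symm
  refine Finset.sum_of_injOn (fun i : Fin (χ + 1 - lam) =>
    ((⟨(i : ℕ) + lam, by have := i.isLt; omega⟩ : Fin (χ + 1)),
      (Fin.castLE (by omega) i : Fin (χ + 1)))) ?_ ?_ ?_ ?_
  · intro x _ y _ hxy
    simpa [Fin.ext_iff] using hxy
  · intro x _
    simp
  · rintro ⟨j, l⟩ _ hjl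
    refine hF j l fun heq => hjl ⟨⟨l, by have := j.isLt; omega⟩, by simp, ?_⟩
    ext <;> simp [heq]
  · intro i _
    rfl

/-- Time-domain content of the paper's Lemma 2: if the input `u` is
quasi-stationary with average power `Pw`, then the Cesàro means of the lagged
output correlations `E[d(k+λ) d(k)]` converge to `r(λ)·Pw`, where
`r(λ) = Σ_{j=0}^{χ̄−λ} R_{j,j+λ}`. -/
theorem output_average_autocorrelation {Ω : Type*} [MeasurableSpace Ω]
    (P : Measure Ω) [IsProbabilityMeasure P]
    (χ : ℕ) (h : ℤ → Ω → Fin (χ + 1) → ℝ) (u : ℤ → Ω → ℝ)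
    (hmeas : ∀ n, Measurable (h n)) (umeas : ∀ n, Measurable (u n))
    (hmean : ∀ n j, ∫ ω, h n ω j ∂P = 0)
    (R : Matrix (Fin (χ + 1)) (Fin (χ + 1)) ℝ)
    (hcov : ∀ n j l, ∫ ω, h n ω j * h n ω l ∂P = R j l)
    (hint : ∀ (n1 n2 : ℤ) (j1 j2 : Fin (χ + 1)),
      Integrable (fun ω => h n1 ω j1 * h n2 ω j2 * u n1 ω * u n2 ω) P)
    (hindep0 : ∀ n, IndepFun (h n) (u n) P)
    (hindep : ∀ n1 n2 : ℤ, n2 < n1 →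
      IndepFun (h n1) (fun ω => (h n2 ω, u n1 ω, u n2 ω)) P)
    (Pw : ℝ)
    (hPw : Tendsto (fun N : ℕ =>
        (1 / (N : ℝ)) * ∑ k ∈ Finset.range N, ∫ ω, u (k : ℤ) ω ^ 2 ∂P)
      atTop (nhds Pw)) :
    ∀ lam : ℕ, ∀ hle : lam ≤ χ,
      Tendsto (fun N : ℕ =>
          (1 / (N : ℝ)) * ∑ k ∈ Finset.range N,
            ∫ ω, (∑ j : Fin (χ + 1),
                    h ((k : ℤ) + lam - (j : ℕ)) ω j * u ((k : ℤ) + lam - (j : ℕ)) ω) *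
                  (∑ j : Fin (χ + 1), h ((k : ℤ) - (j : ℕ)) ω j * u ((k : ℤ) - (j : ℕ)) ω) ∂P)
        atTop
        (nhds ((∑ j : Fin (χ + 1 - lam),
            R (Fin.castLE (by omega) j) ⟨(j : ℕ) + lam, by have := j.isLt; omega⟩) * Pw)) := by
  intro lam hle
  have hsymm : ∀ j l, R j l = R l j := fun j l => by
    rw [← hcov 0 j l, ← hcov 0 l j]
    simp only [mul_comm]
  have hcorr : ∀ k : ℕ,
      ∫ ω, (∑ j : Fin (χ + 1),
              h ((k : ℤ) + lam - (j : ℕ)) ω j * u ((k : ℤ) + lam - (j : ℕ)) ω) *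
            (∑ j : Fin (χ + 1), h ((k : ℤ) - (j : ℕ)) ω j * u ((k : ℤ) - (j : ℕ)) ω) ∂P
        = ∑ i : Fin (χ + 1 - lam),
            R (Fin.castLE (by omega) i) ⟨(i : ℕ) + lam, by have := i.isLt; omega⟩ *
              ∫ ω, u ((k : ℤ) - (i : ℕ)) ω ^ 2 ∂P := by
    intro k
    have hprod : ∀ (n m : ℤ) (j l : Fin (χ + 1)),
        Integrable (fun ω => (h n ω j * u n ω) * (h m ω l * u m ω)) P := fun n m j l =>
      (hint n m j l).congr (Eventually.of_forall fun ω => by ring)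
    simp only [Finset.sum_mul_sum]
    rw [integral_finsetSum _ fun j _ => integrable_finsetSum _ fun l _ => hprod _ _ j l]
    simp only [integral_finsetSum _ fun l _ => hprod _ _ _ l]
    rw [Fin.sum_sum_subdiagonal (lam := lam) _ fun j l hjl =>
      integral_gain_input_eq_zero_of_ne hmeas umeas hmean hindep (by omega) j l]
    refine Finset.sum_congr rfl fun i _ => ?_
    have htime : (k : ℤ) + lam - ((i + lam : ℕ) : ℤ) = k - (i : ℕ) := by push_cast; ring
    simp only [htime, Fin.val_castLE]
    rw [integral_gain_input_same_time hmeas umeas hindep0, hcov, hsymm]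
  simp only [hcorr]
  rw [Finset.sum_mul]
  have hlim := tendsto_finsetSum Finset.univ fun (i : Fin (χ + 1 - lam)) _ =>
    (tendsto_cesaro_delay (a := fun n => ∫ ω, u n ω ^ 2 ∂P) hPw (i : ℕ)).const_mul
      (R (Fin.castLE (by omega) i) ⟨(i : ℕ) + lam, by have := i.isLt; omega⟩)
  refine hlim.congr fun N => ?_
  rw [Finset.sum_comm, Finset.mul_sum]
  refine Finset.sum_congr rfl fun i _ => ?_
  rw [← Finset.mul_sum]
  ring
end
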